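/- Let p, q₁, q₂ be primes with p ≡ 1 (mod 4), q₁ ≡ q₂ ≡ 7 (mod 8), and (q₂/p) = -1. Then the class number of K₁ = Q(√p, √(q₁q₂), √2) is even. -/

import Mathlib

open NumberField

/-- The subfield of ℝ generated over ℚ by a set of real numbers. -/
noncomputable def Qadj (S : Set ℝ) : IntermediateField ℚ ℝ := IntermediateField.adjoin ℚ S


theorem aux_basis {Q : Type*} [CommGroup Q] {r : ℕ} (b : Module.Basis (Fin r) ℤ (Additive Q)) :
    ∃ ψ : Additive Q →+ (Fin r → ZMod 2), Function.Surjective ψ ∧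
      ∀ x : Q, ψ (Additive.ofMul x) = 0 ↔ ∃ w, x = w ^ 2 := by
  let ψ : Additive Q →+ (Fin r → ZMod 2) :=
    ((RingHom.pi (fun i => (Int.castRingHom (ZMod 2)).comp (Pi.evalRingHom (fun _ => ℤ) i)) :
      (Fin r → ℤ) →+* (Fin r → ZMod 2)) : _ →+ _).comp
      b.equivFun.toLinearMap.toAddMonoidHom
  have hψapp : ∀ x i, ψ x i = ((b.equivFun x i : ℤ) : ZMod 2) := fun x i => rfl
  refine ⟨ψ, ?_, ?_⟩
  · intro f
    obtain ⟨z, hz⟩ := b.equivFun.surjective (fun i => ((f i).val : ℤ))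
    refine ⟨z, ?_⟩
    funext i
    rw [hψapp, hz]; simp
  · intro x
    constructor
    · intro hx
      have h2 : ∀ i, ∃ c : ℤ, b.equivFun (Additive.ofMul x) i = 2 * c := by
        intro i
        have := congrFun hx i
        rw [hψapp] at this
        exact (ZMod.intCast_zmod_eq_zero_iff_dvd _ 2).mp this
      choose c hc using h2
      obtain ⟨z, hz⟩ := b.equivFun.surjective c
      have h4 : Additive.ofMul x = z + z := by
        apply b.equivFun.injective
        funext i
        rw [hc, map_add, hz]; simp [two_mul]
      refine ⟨Additive.toMul z, ?_⟩
      rw [pow_two]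
      exact h4
    · rintro ⟨w, rfl⟩
      rw [ofMul_pow, map_nsmul]
      funext i
      simp only [Pi.smul_apply, Pi.zero_apply, nsmul_eq_mul]
      have : ((2 : ℕ) : ZMod 2) = 0 := by decide
      rw [this, zero_mul]

theorem aux_sq_index (K : Type*) [Field K] [NumberField K] :
    (powMonoidHom 2 : (𝓞 K)ˣ →* (𝓞 K)ˣ).range.index = 2 ^ (Units.rank K + 1) := by
  classical
  set S := (powMonoidHom 2 : (𝓞 K)ˣ →* (𝓞 K)ˣ).range with hS
  set T := Units.torsion K with hT
  obtain ⟨ψ0, hψ0, hψ0k⟩ := aux_basis (Units.basisModTorsion K)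
  let ψ : Additive (𝓞 K)ˣ →+ (Fin (Units.rank K) → ZMod 2) :=
    ψ0.comp (MonoidHom.toAdditive (QuotientGroup.mk' T))
  have hψapp : ∀ x : (𝓞 K)ˣ, ψ (Additive.ofMul x) =
      ψ0 (Additive.ofMul (QuotientGroup.mk x : (𝓞 K)ˣ ⧸ T)) := by
    intro x; rfl
  have hsurj : Function.Surjective ψ := by
    intro f
    obtain ⟨z, hz⟩ := hψ0 f
    obtain ⟨x, hx⟩ := QuotientGroup.mk_surjective (s := T) (Additive.toMul z)
    refine ⟨Additive.ofMul x, ?_⟩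
    rw [hψapp, hx]
    exact hz
  have hker : AddSubgroup.toSubgroup' ψ.ker = S ⊔ T := by
    apply le_antisymm
    · intro x hx
      have hx' : ψ (Additive.ofMul x) = 0 := hx
      rw [hψapp, hψ0k] at hx'
      obtain ⟨z, hz⟩ := hx'
      obtain ⟨w, hw⟩ := QuotientGroup.mk_surjective (s := T) z
      have h5 : (QuotientGroup.mk x : (𝓞 K)ˣ ⧸ T) = QuotientGroup.mk (w ^ 2) := by
        rw [hz, ← hw]; rfl
      have h6 := QuotientGroup.eq.mp h5.symm
      rw [Subgroup.mem_sup]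
      exact ⟨w ^ 2, ⟨w, rfl⟩, _, h6, by simp⟩
    · rw [sup_le_iff]
      constructor
      · rintro _ ⟨w, rfl⟩
        change ψ (Additive.ofMul (w ^ 2)) = 0
        rw [hψapp, hψ0k]
        exact ⟨QuotientGroup.mk w, rfl⟩
      · intro x hx
        change ψ (Additive.ofMul x) = 0
        rw [hψapp, (QuotientGroup.eq_one_iff x).mpr hx, ofMul_one, map_zero]
  have hidx : (S ⊔ T).index = 2 ^ Units.rank K := by
    rw [← hker]
    change ψ.ker.index = _
    rw [AddSubgroup.index_ker, AddMonoidHom.range_eq_top.mpr hsurj]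
    simp
  have hrel : S.relIndex T = 2 := by
    have h1 : S.subgroupOf T = (powMonoidHom 2 : T →* T).range := by
      ext ⟨x, hx⟩
      rw [Subgroup.mem_subgroupOf]
      constructor
      · rintro ⟨w, hw⟩
        have hwT : w ∈ T := by
          have hw' : w ^ 2 = x := hw
          rw [hT, Units.torsion, CommGroup.mem_torsion] at hx ⊢
          rw [← hw'] at hx
          exact hx.of_pow (by norm_num)
        exact ⟨⟨w, hwT⟩, Subtype.ext hw⟩
      · rintro ⟨w, hw⟩
        exact ⟨w, congrArg Subtype.val hw⟩
    rw [Subgroup.relIndex, h1, IsCyclic.index_powMonoidHom_range, Nat.gcd_eq_right_iff_dvd]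
    exact Even.two_dvd <| Units.even_torsionOrder K
  rw [← Subgroup.relIndex_mul_index (le_sup_left : S ≤ S ⊔ T), Subgroup.relIndex_sup_left, hrel, hidx]
  ring

theorem aux_group {F E : Type*} [CommGroup F] [CommGroup E] (i : F →* E)
    (hi : Function.Injective i) (σ : E →* E) (hσσ : ∀ e, σ (σ e) = e)
    (hσi : ∀ f, σ (i f) = i f)
    (hfix : ∀ e, σ e = e → ∃ f, i f = e) (m : E) (hm : m ≠ 1) (hm2 : m * m = 1)
    (hσm : σ m = m) (htor : ∀ e : E, e * e = 1 → e = 1 ∨ e = m)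
    (h90 : ∀ u, u * σ u = 1 → ∃ v, u * σ v = v)
    (hF : (powMonoidHom 2 : F →* F).range.index ≠ 0)
    (hE : (powMonoidHom 2 : F →* F).range.index ^ 2 ≤ (powMonoidHom 2 : E →* E).range.index) :
    False := by
  set SF := (powMonoidHom 2 : F →* F).range with hSF
  set SE := (powMonoidHom 2 : E →* E).range with hSE
  obtain ⟨v, hv⟩ := h90 m (by rw [hσm, hm2])
  have hσv : σ v = m * v := by
    calc σ v = (m * m) * σ v := by rw [hm2, one_mul]
      _ = m * v := by rw [mul_assoc, hv]
  obtain ⟨c, hc⟩ := hfix (v * v) (by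
    rw [map_mul, hσv, mul_mul_mul_comm, hm2, one_mul])
  have hcS : c ∉ SF := by
    rintro ⟨d, hd⟩
    have hd' : d * d = c := by rw [← hd]; simp [pow_two]
    have h1 : (v * (i d)⁻¹) * (v * (i d)⁻¹) = 1 := by
      rw [mul_mul_mul_comm, ← hc, ← hd', map_mul, ← mul_inv, mul_inv_cancel]
    have h2 : σ v = v := by
      rcases htor _ h1 with h | h
      · have : v = i d := by rwa [mul_inv_eq_one] at h
        rw [this, hσi]
      · have : v = m * i d := by rw [← h]; simp
        rw [this, map_mul, hσi, hσm]
    rw [h2] at hσv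
    exact hm (by simpa using hσv.symm)
  have hle : SF ≤ SE.comap i := by
    rintro _ ⟨d, rfl⟩
    exact ⟨i d, by simp⟩
  have hk : SF.relIndex (SE.comap i) * (SE.comap i).index = SF.index :=
    Subgroup.relIndex_mul_index hle
  have hrel1 : SF.relIndex (SE.comap i) ≠ 1 := by
    rw [Ne, Subgroup.relIndex_eq_one]
    intro h
    exact hcS (h ⟨v, by simp [pow_two, hc]⟩)
  have hrel0 : SF.relIndex (SE.comap i) ≠ 0 := by
    intro h; rw [h, zero_mul] at hk; exact hF hk.symm
  have hk2 : 2 * (SE.comap i).index ≤ SF.index := by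
    rw [← hk]; exact Nat.mul_le_mul_right _ (by omega)
  let f : E →* E := (MonoidHom.id E) * σ
  have hfapp : ∀ e, f e = e * σ e := fun e => rfl
  have hfr : f.range ≤ i.range := by
    rintro _ ⟨e, rfl⟩
    obtain ⟨g, hg⟩ := hfix (f e) (by rw [hfapp, map_mul, hσσ, mul_comm])
    exact ⟨g, hg⟩
  have hH : (SF.map i).comap f = SE ⊔ i.range := by
    apply le_antisymm
    · rintro e ⟨_, ⟨w, rfl⟩, hw⟩
      have hw' : i w * i w = e * σ e := by rw [← hfapp, ← hw]; simp [pow_two]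
      obtain ⟨t, ht⟩ := h90 (e * (i w)⁻¹) (by
        rw [map_mul, map_inv, hσi, mul_mul_mul_comm, ← hw', ← mul_inv, mul_inv_cancel])
      obtain ⟨g, hg⟩ := hfr ⟨t, rfl⟩
      rw [hfapp] at hg
      rw [Subgroup.mem_sup]
      refine ⟨t ^ 2, ⟨t, rfl⟩, i (w * g⁻¹), ⟨_, rfl⟩, ?_⟩
      have h3 : e * σ t = t * i w := by
        calc e * σ t = (e * (i w)⁻¹ * σ t) * i w := by
              rw [mul_right_comm, inv_mul_cancel_right]
          _ = t * i w := by rw [ht]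
      rw [map_mul, map_inv, hg]
      have h4 : e = t * i w * (σ t)⁻¹ := by rw [← h3]; simp
      rw [h4, pow_two]
      simp only [mul_inv]
      calc t * t * (i w * (t⁻¹ * (σ t)⁻¹)) = (t * t⁻¹) * (t * i w * (σ t)⁻¹) := by
            simp only [mul_assoc, mul_comm, mul_left_comm]
        _ = _ := by rw [mul_inv_cancel, one_mul]
    · rw [sup_le_iff]
      constructor
      · rintro _ ⟨t, rfl⟩
        obtain ⟨g, hg⟩ := hfr ⟨t, rfl⟩
        refine ⟨g ^ 2, ⟨g, rfl⟩, ?_⟩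
        simp [hg]
      · rintro _ ⟨g, rfl⟩
        refine ⟨g ^ 2, ⟨g, rfl⟩, ?_⟩
        rw [hfapp, hσi, map_pow, pow_two]
  have hrr : (SF.map i).relIndex i.range = SF.index := by
    rw [MonoidHom.range_eq_map, Subgroup.relIndex_map_map_of_injective _ _ hi,
      Subgroup.relIndex_top_right]
  have h5 : (SE ⊔ i.range).index ≤ SF.index := by
    rw [← hH, Subgroup.index_comap, ← hrr]
    exact Subgroup.relIndex_le_of_le_right hfr (by rwa [hrr])
  have h6 : SE.relIndex i.range = (SE.comap i).index := (Subgroup.index_comap _ _).symm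
  have h7 : SE.relIndex (SE ⊔ i.range) * (SE ⊔ i.range).index = SE.index :=
    Subgroup.relIndex_mul_index le_sup_left
  rw [Subgroup.relIndex_sup_left, h6] at h7
  have hpos : 0 < SF.index := Nat.pos_of_ne_zero hF
  nlinarith

theorem aux_h90 {R S : Type*} [CommRing R] [IsDedekindDomain R] [CommRing S] [IsDomain S]
    [Algebra R S] [Finite (ClassGroup R)]
    (hodd : ¬ Even (Nat.card (ClassGroup R)))
    (σ : S →+* S) (hσσ : ∀ x, σ (σ x) = x) (hσR : ∀ r, σ (algebraMap R S r) = algebraMap R S r)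
    (hfix : ∀ x, σ x = x → ∃ r, algebraMap R S r = x)
    (g : S) (hg : g ≠ 0) (hσg : σ g = - g)
    (θ₁ θ₂ : S) (hcop : IsCoprime (θ₁ - σ θ₁) (θ₂ - σ θ₂))
    (u : Sˣ) (hu : (u : S) * σ u = 1) : ∃ v : Sˣ, (u : S) * σ v = v := by
  obtain ⟨y, hy0, hy⟩ : ∃ y : S, y ≠ 0 ∧ (u : S) * σ y = y := by
    by_cases h : (1 : S) + u = 0
    · refine ⟨g, hg, ?_⟩
      have : (u : S) = -1 := by linear_combination h
      rw [this, hσg]; ring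
    · refine ⟨1 + u, h, ?_⟩
      rw [map_add, map_one, mul_add, hu]; ring
  have huinv : (u : S) * ((u⁻¹ : Sˣ) : S) = 1 := by simp
  set J : Ideal S := Ideal.span {y} with hJ
  have hJσ : ∀ x ∈ J, σ x ∈ J := by
    intro x hx
    obtain ⟨a, rfl⟩ := Ideal.mem_span_singleton.mp hx
    rw [map_mul]
    apply Ideal.mul_mem_right
    rw [Ideal.mem_span_singleton]
    exact ⟨((u⁻¹ : Sˣ) : S), by
      calc σ y = (u : S) * ((u⁻¹ : Sˣ) : S) * σ y := by rw [huinv, one_mul]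
        _ = (u * σ y) * ((u⁻¹ : Sˣ) : S) := by ring
        _ = _ := by rw [hy]⟩
  set B : Ideal R := J.comap (algebraMap R S) with hB
  have hdescend : ∀ x ∈ J, x + σ x ∈ B.map (algebraMap R S) := by
    intro x hx
    obtain ⟨r, hr⟩ := hfix (x + σ x) (by rw [map_add, hσσ, add_comm])
    rw [← hr]
    apply Ideal.mem_map_of_mem
    rw [hB, Ideal.mem_comap, hr]
    exact J.add_mem hx (hJσ x hx)
  have hmul : ∀ θ x, x ∈ J → (θ - σ θ) * x ∈ B.map (algebraMap R S) := by
    intro θ x hx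
    have e : (θ - σ θ) * x = (x * θ + σ (x * θ)) - (x + σ x) * σ θ := by
      rw [map_mul]; ring
    rw [e]
    exact Ideal.sub_mem _ (hdescend _ (J.mul_mem_right _ hx))
      (Ideal.mul_mem_right _ _ (hdescend _ hx))
  have hJB : B.map (algebraMap R S) = J := by
    apply le_antisymm Ideal.map_comap_le
    intro x hx
    obtain ⟨a, b, hab⟩ := hcop
    have : x = a * ((θ₁ - σ θ₁) * x) + b * ((θ₂ - σ θ₂) * x) := by
      linear_combination (-x) * hab
    rw [this]
    exact Ideal.add_mem _ (Ideal.mul_mem_left _ _ (hmul _ _ hx))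
      (Ideal.mul_mem_left _ _ (hmul _ _ hx))
  have hB0 : B ≠ ⊥ := by
    intro h
    rw [h, Ideal.map_bot] at hJB
    exact hy0 (Ideal.span_singleton_eq_bot.mp hJB.symm)
  set h := Nat.card (ClassGroup R) with hh
  have hprin : (B ^ h).IsPrincipal := by
    have hBm : B ∈ nonZeroDivisors (Ideal R) := mem_nonZeroDivisors_of_ne_zero hB0
    have h1 : ClassGroup.mk0 ⟨B, hBm⟩ ^ h = 1 := by
      rw [hh]; exact pow_card_eq_one'
    rw [← map_pow, SubmonoidClass.mk_pow] at h1
    exact (ClassGroup.mk0_eq_one_iff _).mp h1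
  obtain ⟨b, hb⟩ := hprin
  have hass : Ideal.span {y ^ h} = Ideal.span {algebraMap R S b} := by
    rw [← Ideal.span_singleton_pow, ← hJ, ← hJB, ← Ideal.map_pow, hb]
    change Ideal.map _ (Ideal.span {b}) = _
    rw [Ideal.map_span, Set.image_singleton]
  obtain ⟨w, hw⟩ := Ideal.span_singleton_eq_span_singleton.mp hass.symm
  have hb0 : algebraMap R S b ≠ 0 := by
    intro h0; rw [h0, zero_mul] at hw; exact pow_ne_zero _ hy0 hw.symm
  have hw2 : (u : S) ^ h * σ w = w := by
    apply mul_left_cancel₀ hb0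
    calc algebraMap R S b * ((u : S) ^ h * σ w) = u ^ h * (σ (algebraMap R S b * w)) := by
          rw [map_mul, hσR]; ring
      _ = (u * σ y) ^ h := by rw [hw, map_pow, mul_pow]
      _ = _ := by rw [hy, hw]
  obtain ⟨k, hk⟩ := Nat.not_even_iff_odd.mp hodd
  refine ⟨u⁻¹ ^ k * w, ?_⟩
  have hσu : σ ((u⁻¹ : Sˣ) : S) = u := by
    have h1 : σ (u : S) * σ ((u⁻¹ : Sˣ) : S) = 1 := by rw [← map_mul, huinv, map_one]
    calc σ ((u⁻¹ : Sˣ) : S) = (u * σ u) * σ ((u⁻¹ : Sˣ) : S) := by rw [hu, one_mul]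
      _ = u * (σ (u : S) * σ ((u⁻¹ : Sˣ) : S)) := by ring
      _ = u := by rw [h1, mul_one]
  rw [Units.val_mul, Units.val_pow_eq_pow_val, map_mul, map_pow, hσu]
  have h3 : (u : S) ^ h = u ^ (2 * k + 1) := by rw [hk]
  rw [h3] at hw2
  have h4 : ((u⁻¹ : Sˣ) : S) ^ k * (u : S) ^ k = 1 := by
    rw [← mul_pow, mul_comm, huinv, one_pow]
  calc (u : S) * (u ^ k * σ w) = (((u⁻¹ : Sˣ) : S) ^ k * (u : S) ^ k) * (u * (u ^ k * σ w)) := by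
        rw [h4, one_mul]
    _ = ((u⁻¹ : Sˣ) : S) ^ k * (u ^ (2 * k + 1) * σ w) := by ring
    _ = _ := by rw [hw2]


theorem aux_rank (K : Type*) [Field K] [NumberField K] [IsTotallyReal K] :
    Units.rank K + 1 = Module.finrank ℚ K := by
  have h1 := InfinitePlace.card_eq_nrRealPlaces_add_nrComplexPlaces K
  rw [IsTotallyReal.nrComplexPlaces_eq_zero, add_zero, ← IsTotallyReal.finrank] at h1
  have h2 : 0 < Module.finrank ℚ K := Module.finrank_pos
  unfold Units.rank
  rw [h1]
  omega

theorem aux_field (K M : Type*) [Field K] [NumberField K] [Field M] [NumberField M] [Algebra K M]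
    [IsTotallyReal K] [IsTotallyReal M] (hdeg : Module.finrank K M = 2)
    (σ : M →ₐ[K] M) (hσσ : ∀ x, σ (σ x) = x)
    (hfix : ∀ x, σ x = x → ∃ k, algebraMap K M k = x)
    (θ₁ θ₂ g : 𝓞 M) (hg : g ≠ 0) (hσg : σ (g : M) = - (g : M))
    (hcop : IsCoprime (θ₁ - RingOfIntegers.mapRingHom (σ : M →+* M) θ₁)
      (θ₂ - RingOfIntegers.mapRingHom (σ : M →+* M) θ₂)) :
    Even (Nat.card (ClassGroup (𝓞 K))) := by
  by_contra hodd
  set τ : 𝓞 M →+* 𝓞 M := RingOfIntegers.mapRingHom (σ : M →+* M) with hτ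
  have hτapp : ∀ x : 𝓞 M, ((τ x : 𝓞 M) : M) = σ (x : M) := fun x => rfl
  have hal : ∀ r : 𝓞 K, ((algebraMap (𝓞 K) (𝓞 M) r : 𝓞 M) : M) = algebraMap K M (r : K) :=
    fun r => rfl
  have hττ : ∀ x, τ (τ x) = x := fun x => by
    apply RingOfIntegers.ext; rw [hτapp, hτapp, hσσ]
  have hτR : ∀ r, τ (algebraMap (𝓞 K) (𝓞 M) r) = algebraMap (𝓞 K) (𝓞 M) r := fun r => by
    apply RingOfIntegers.ext; rw [hτapp, hal, AlgHom.commutes]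
  have hτfix : ∀ x, τ x = x → ∃ r, algebraMap (𝓞 K) (𝓞 M) r = x := by
    intro x hx
    obtain ⟨k, hk⟩ := hfix (x : M) (by rw [← hτapp, hx])
    have h_integral : IsIntegral ℤ k := by
      have h1 : IsIntegral ℤ (algebraMap K M k) := by rw [hk]; exact x.isIntegral_coe
      exact (isIntegral_algebraMap_iff (algebraMap K M).injective).mp h1
    refine ⟨⟨k, h_integral⟩, ?_⟩
    apply RingOfIntegers.ext
    exact (hal _).trans hk
  have hinj : Function.Injective (algebraMap (𝓞 K) (𝓞 M)) := by
    intro a b hab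
    apply RingOfIntegers.ext
    apply (algebraMap K M).injective
    rw [← hal, ← hal, hab]
  have h90 := aux_h90 hodd τ hττ hτR hτfix g hg
    (by apply RingOfIntegers.ext; rw [hτapp, hσg]; rfl) θ₁ θ₂ hcop
  refine aux_group (Units.map (algebraMap (𝓞 K) (𝓞 M) : 𝓞 K →* 𝓞 M)) (Units.map_injective hinj)
    (Units.map (τ : 𝓞 M →* 𝓞 M)) ?_ ?_ ?_ (-1) ?_ ?_ ?_ ?_ ?_ ?_ ?_
  · intro e; ext1; exact hττ _
  · intro f; ext1; exact hτR _
  · intro e he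
    have h1 : τ (e : 𝓞 M) = e := congrArg Units.val he
    obtain ⟨r, hr⟩ := hτfix _ h1
    have h2 : τ ((e⁻¹ : (𝓞 M)ˣ) : 𝓞 M) = ((e⁻¹ : (𝓞 M)ˣ) : 𝓞 M) := by
      have := congrArg (fun z : (𝓞 M)ˣ => ((z⁻¹ : (𝓞 M)ˣ) : 𝓞 M)) he
      simp only [← map_inv] at this
      exact this
    obtain ⟨r', hr'⟩ := hτfix _ h2
    have h3 : r * r' = 1 := by
      apply hinj
      rw [map_mul, hr, hr', map_one]; simp
    refine ⟨⟨r, r', h3, by rw [mul_comm, h3]⟩, ?_⟩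
    ext1
    exact hr
  · intro h
    have h1 : (-1 : 𝓞 M) = 1 := by simpa using congrArg Units.val h
    have h2 : (2 : 𝓞 M) = 0 := by linear_combination -h1
    exact two_ne_zero h2
  · simp
  · ext1; simp
  · intro e he
    have h1 : (e : 𝓞 M) * e = 1 := by simpa using congrArg Units.val he
    rcases mul_self_eq_one_iff.mp h1 with h | h
    · left; ext1; simpa using h
    · right; ext1; simpa using h
  · intro u hu
    obtain ⟨v, hv⟩ := h90 u (by simpa using congrArg Units.val hu)
    exact ⟨v, by ext1; exact hv⟩
  · rw [aux_sq_index]; positivity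
  · rw [aux_sq_index, aux_sq_index, aux_rank, aux_rank, ← pow_mul]
    apply Nat.pow_le_pow_right (by norm_num)
    rw [← Module.finrank_mul_finrank ℚ K M, hdeg]

theorem aux_real {z : ℂ} {r : ℝ} (hr : 0 ≤ r) (hz : z ^ 2 = (r : ℂ)) :
    (starRingEnd ℂ) z = z := by
  have h1 : (z - (Real.sqrt r : ℂ)) * (z + (Real.sqrt r : ℂ)) = 0 := by
    have : ((Real.sqrt r : ℝ) : ℂ) ^ 2 = (r : ℂ) := by
      rw [← Complex.ofReal_pow, Real.sq_sqrt hr]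
    linear_combination hz - this
  rcases mul_eq_zero.mp h1 with h | h
  · rw [sub_eq_zero.mp h]; exact Complex.conj_ofReal _
  · rw [eq_neg_of_add_eq_zero_left h, map_neg, Complex.conj_ofReal]

theorem aux_int {M : Type*} [Field M] {c d θ : M} (hc : IsIntegral ℤ c) (hd : IsIntegral ℤ d)
    (h : θ ^ 2 = c * θ - d) : IsIntegral ℤ θ := by
  have h1 : IsIntegral (integralClosure ℤ M) θ := by
    refine ⟨Polynomial.X ^ 2 + (Polynomial.C (-(⟨c, hc⟩ : integralClosure ℤ M)) * Polynomial.X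
      + Polynomial.C ⟨d, hd⟩), ?_, ?_⟩
    · apply Polynomial.monic_X_pow_add
      refine lt_of_le_of_lt Polynomial.degree_linear_le ?_
      norm_num
    · have hc' : (algebraMap (integralClosure ℤ M) M) ⟨c, hc⟩ = c := rfl
      have hd' : (algebraMap (integralClosure ℤ M) M) ⟨d, hd⟩ = d := rfl
      simp only [Polynomial.eval₂_add, Polynomial.eval₂_mul, Polynomial.eval₂_X_pow,
        Polynomial.eval₂_C, Polynomial.eval₂_X, Polynomial.C_neg, Polynomial.eval₂_neg, hc', hd']
      rw [h]; ring
  exact isIntegral_trans θ h1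

theorem aux_theta {M : Type*} [Field M] [CharZero M] {A B : ℤ} {s γ : M}
    (hs : s ^ 2 = 2) (hγ : γ ^ 2 = A + B * s)
    (hAB : (A % 4 = 1 ∧ B % 4 = 0) ∨ (A % 4 = 3 ∧ B % 4 = 2)) :
    ∃ n : ℤ, IsIntegral ℤ ((1 + n * s + γ) / 2) := by
  have hZ : ∀ n : ℤ, IsIntegral ℤ (n : M) := fun n => by
    simpa using (isIntegral_algebraMap (R := ℤ) (A := M) (x := n))
  have hsi : IsIntegral ℤ s := aux_int (c := ((0 : ℤ) : M)) (d := ((-2 : ℤ) : M)) (hZ _) (hZ _)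
    (by rw [hs]; push_cast; ring)
  have key : ∃ n a b : ℤ, (1 + (n : M) * s) ^ 2 = A + B * s - 4 * (a + b * s) := by
    rcases hAB with ⟨h1, h2⟩ | ⟨h1, h2⟩
    · refine ⟨0, A / 4, B / 4, ?_⟩
      have hA : A = 1 + 4 * (A / 4) := by omega
      have hB : B = 4 * (B / 4) := by omega
      have hA' : (A : M) = 1 + 4 * ((A / 4 : ℤ) : M) := by exact_mod_cast congrArg (Int.cast : ℤ → M) hA
      have hB' : (B : M) = 4 * ((B / 4 : ℤ) : M) := by exact_mod_cast congrArg (Int.cast : ℤ → M) hB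
      rw [Int.cast_zero]
      linear_combination -hA' - s * hB'
    · refine ⟨1, A / 4, B / 4, ?_⟩
      have hA : A = 3 + 4 * (A / 4) := by omega
      have hB : B = 2 + 4 * (B / 4) := by omega
      have hA' : (A : M) = 3 + 4 * ((A / 4 : ℤ) : M) := by exact_mod_cast congrArg (Int.cast : ℤ → M) hA
      have hB' : (B : M) = 2 + 4 * ((B / 4 : ℤ) : M) := by exact_mod_cast congrArg (Int.cast : ℤ → M) hB
      rw [Int.cast_one]
      linear_combination -hA' - s * hB' + hs
  obtain ⟨n, a, b, hk⟩ := key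
  refine ⟨n, ?_⟩
  refine aux_int (c := ((1 : ℤ) : M) + n * s) (d := -((a : M) + b * s))
    ((hZ _).add ((hZ _).mul hsi)) ((hZ _).add ((hZ _).mul hsi)).neg ?_
  rw [Int.cast_one]
  field_simp
  linear_combination hγ - hk


theorem aux_concrete_abs (K M : Type*) [Field K] [NumberField K] [IsTotallyReal K]
    [Field M] [NumberField M] [Algebra K M] (s t : K)
    (A B : ℤ) (hs : s ^ 2 = 2) (ht : t ^ 2 = A ^ 2 - 2 * B ^ 2) (hA : 0 < A)
    (hN : 0 < A ^ 2 - 2 * B ^ 2)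
    (hAB : (A % 4 = 1 ∧ B % 4 = 0) ∨ (A % 4 = 3 ∧ B % 4 = 2))
    (hco : IsCoprime (2 * A) (A ^ 2 - 2 * B ^ 2))
    (hdeg : Module.finrank K M = 2)
    (σ : M →ₐ[K] M) (hσσ : ∀ x, σ (σ x) = x)
    (hfix : ∀ x, σ x = x → ∃ k, algebraMap K M k = x)
    (γ : M) (hσγ : σ γ = -γ) (hγ : γ ^ 2 = algebraMap K M (A + B * s)) (hγ0 : γ ≠ 0)
    (hdecomp : ∀ x : M, ∃ a b : K, x = algebraMap K M a + algebraMap K M b * γ) :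
    Even (Nat.card (ClassGroup (𝓞 K))) := by
  have hγ' : γ ^ 2 = A + B * algebraMap K M s := by
    rw [hγ, map_add, map_mul, map_intCast, map_intCast]
  obtain ⟨s', hs'⟩ : ∃ s', s' = algebraMap K M s := ⟨_, rfl⟩
  obtain ⟨t', ht'⟩ : ∃ t', t' = algebraMap K M t := ⟨_, rfl⟩
  rw [← hs'] at hγ'
  have hιs : s' ^ 2 = 2 := by rw [hs', ← map_pow, hs, map_ofNat]
  have hσs : σ s' = s' := by rw [hs', AlgHom.commutes]
  have hσt : σ t' = t' := by rw [ht', AlgHom.commutes]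
  obtain ⟨δ, hδdef⟩ : ∃ δ, δ = t' / γ := ⟨_, rfl⟩
  have hσδ : σ δ = -δ := by
    rw [hδdef, map_div₀, hσt, hσγ, div_neg]
  have hγδ : γ * δ = t' := by rw [hδdef]; field_simp
  have hιt : t' ^ 2 = A ^ 2 - 2 * B ^ 2 := by 
    rw [ht', ← map_pow, ht, map_sub, map_mul, map_pow, map_pow, map_intCast, map_intCast, map_ofNat]
  have hδ : δ ^ 2 = A + B * (- s') := by
    have h1 : γ ^ 2 * δ ^ 2 = γ ^ 2 * (A + B * (- s')) := by
      rw [← mul_pow, hγδ, hιt, hγ']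
      linear_combination (B : M) ^ 2 * hιs
    exact mul_left_cancel₀ (pow_ne_zero 2 hγ0) h1
  obtain ⟨n₁, hn₁⟩ := aux_theta hιs hγ' hAB
  obtain ⟨n₂, hn₂⟩ := aux_theta (by rw [neg_sq, hιs]) hδ hAB
  have hreal : IsTotallyReal M := by
    refine ⟨fun v => InfinitePlace.isReal_iff.mpr ?_⟩
    obtain ⟨φ, hφ⟩ : ∃ φ : M →+* ℂ, φ = v.embedding := ⟨_, rfl⟩
    rw [← hφ]
    have hK : ∀ k, (starRingEnd ℂ) (φ (algebraMap K M k)) = φ (algebraMap K M k) := by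
      intro k
      have h1 := IsTotallyReal.complexEmbedding_isReal (φ.comp (algebraMap K M))
      exact RingHom.congr_fun h1 k
    obtain ⟨x, hx⟩ := Complex.conj_eq_iff_real.mp (hK s)
    rw [← hs'] at hx
    have hx2 : x ^ 2 = 2 := by
      have h2 : (φ s') ^ 2 = 2 := by rw [← map_pow, hιs, map_ofNat]
      rw [hx] at h2
      exact_mod_cast h2
    have hpos : 0 ≤ (A : ℝ) + B * x := by
      have hN' : (0 : ℝ) < A ^ 2 - 2 * B ^ 2 := by exact_mod_cast hN
      have hA' : (0 : ℝ) < A := by exact_mod_cast hA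
      by_contra hneg
      push Not at hneg
      have h3 : 0 < (A : ℝ) - B * x := by linarith
      have h4 : ((A : ℝ) + B * x) * (A - B * x) = A ^ 2 - 2 * B ^ 2 := by
        linear_combination (-(B : ℝ) ^ 2) * hx2
      nlinarith
    have hφγ : (starRingEnd ℂ) (φ γ) = φ γ := by
      apply aux_real hpos
      rw [← map_pow, hγ', map_add, map_mul, hx, map_intCast, map_intCast]
      push_cast
      rfl
    rw [ComplexEmbedding.isReal_iff]
    ext y
    obtain ⟨a, b, hy⟩ := hdecomp y
    rw [ComplexEmbedding.conjugate_coe_eq, hy, map_add, map_mul, map_add, map_mul, hK, hK, hφγ]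
  obtain ⟨θ₁, hθ₁⟩ : ∃ θ : 𝓞 M, (θ : M) = (1 + n₁ * s' + γ) / 2 := ⟨⟨_, hn₁⟩, rfl⟩
  obtain ⟨θ₂, hθ₂⟩ : ∃ θ : 𝓞 M, (θ : M) = (1 + n₂ * -s' + δ) / 2 := ⟨⟨_, hn₂⟩, rfl⟩
  have hτ₁ : ((θ₁ - RingOfIntegers.mapRingHom (σ : M →+* M) θ₁ : 𝓞 M) : M) = γ := by
    change (θ₁ : M) - σ (θ₁ : M) = γ
    rw [hθ₁, map_div₀, map_add, map_add, map_mul, hσs, hσγ, map_one, map_intCast, map_ofNat]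
    ring
  have hτ₂ : ((θ₂ - RingOfIntegers.mapRingHom (σ : M →+* M) θ₂ : 𝓞 M) : M) = δ := by
    change (θ₂ : M) - σ (θ₂ : M) = δ
    rw [hθ₂, map_div₀, map_add, map_add, map_mul, map_neg, hσs, hσδ, map_one, map_intCast,
      map_ofNat]
    ring
  obtain ⟨u, w, huw⟩ := hco
  refine aux_field K M hdeg σ hσσ hfix θ₁ θ₂
    (θ₁ - RingOfIntegers.mapRingHom (σ : M →+* M) θ₁) ?_ ?_ ?_
  · intro h
    rw [h] at hτ₁
    exact hγ0 (hτ₁.symm.trans (map_zero _))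
  · rw [hτ₁, hσγ]
  · generalize θ₁ - RingOfIntegers.mapRingHom (σ : M →+* M) θ₁ = G at *
    generalize θ₂ - RingOfIntegers.mapRingHom (σ : M →+* M) θ₂ = D at *
    refine ⟨u * G + w * G * D ^ 2, u * D, ?_⟩
    apply RingOfIntegers.ext
    change ((((u : ℤ) : 𝓞 M) : M) * (G : M) + (((w : ℤ) : 𝓞 M) : M) * (G : M) * (D : M) ^ 2) * (G : M)
      + (((u : ℤ) : 𝓞 M) : M) * (D : M) * (D : M) = 1
    have hcast : ∀ m : ℤ, (((m : ℤ) : 𝓞 M) : M) = (m : M) :=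
      fun m => map_intCast (algebraMap (𝓞 M) M) m
    rw [hτ₁, hτ₂, hcast, hcast]
    have huw' : (u : M) * (2 * A) + w * (A ^ 2 - 2 * B ^ 2) = 1 := by
      exact_mod_cast congrArg (Int.cast : ℤ → M) huw
    have h5 : γ ^ 2 * δ ^ 2 = A ^ 2 - 2 * B ^ 2 := by rw [← mul_pow, hγδ, hιt]
    linear_combination huw' + u * hγ' + u * hδ + w * h5

theorem aux_concrete (K : Type*) [Field K] [NumberField K] [IsTotallyReal K] (s t : K)
    (A B : ℤ) (hs : s ^ 2 = 2) (ht : t ^ 2 = A ^ 2 - 2 * B ^ 2) (hA : 0 < A)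
    (hN : 0 < A ^ 2 - 2 * B ^ 2)
    (hAB : (A % 4 = 1 ∧ B % 4 = 0) ∨ (A % 4 = 3 ∧ B % 4 = 2))
    (hco : IsCoprime (2 * A) (A ^ 2 - 2 * B ^ 2))
    (hns : ∀ r : K, r ^ 2 ≠ A + B * s) : Even (Nat.card (ClassGroup (𝓞 K))) := by
  obtain ⟨α, hα⟩ : ∃ α : K, α = A + B * s := ⟨_, rfl⟩
  have : Fact (∀ r : K, r ^ 2 ≠ α + 0 * r) := ⟨fun r => by simpa [hα] using hns r⟩
  have : NumberField (QuadraticAlgebra K α 0) :=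
    { to_charZero := inferInstance
      to_finiteDimensional := Module.Finite.trans K (QuadraticAlgebra K α 0) }
  have hα0 : α ≠ 0 := fun h => hns 0 (by rw [zero_pow two_ne_zero, ← hα, h])
  refine aux_concrete_abs K (QuadraticAlgebra K α 0) s t A B hs ht hA hN hAB hco
    (QuadraticAlgebra.finrank_eq_two _ _)
    { toFun := fun x => star x
      map_one' := star_one _
      map_mul' := fun x y => by rw [star_mul, mul_comm]
      map_zero' := star_zero _
      map_add' := star_add
      commutes' := fun r => by ext <;> simp }
    (fun x => star_star x) ?_ (QuadraticAlgebra.omega) ?_ ?_ ?_ ?_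
  · intro x hx
    replace hx : star x = x := hx
    refine ⟨x.re, ?_⟩
    have h1 : -x.im = x.im := by
      have := congrArg QuadraticAlgebra.im hx
      simpa using this
    have h2 : x.im = 0 := by
      have : (2 : K) * x.im = 0 := by linear_combination -h1
      simpa using this
    ext
    · simp
    · simp [h2]
  · change star QuadraticAlgebra.omega = _
    ext <;> simp
  · rw [← hα, pow_two]
    ext <;> simp
  · intro h
    have := congrArg QuadraticAlgebra.im h
    simp at this
  · intro x
    refine ⟨x.re, x.im, ?_⟩
    ext <;> simp


theorem aux_pell (q : ℕ) (hq : q.Prime) (h8 : q % 8 = 7) :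
    ∃ x y : ℤ, 0 < x ∧ x ^ 2 - 2 * y ^ 2 = q := by
  have := Fact.mk hq
  have hq2 : q ≠ 2 := by omega
  obtain ⟨s, hs⟩ := (ZMod.exists_sq_eq_two_iff hq2).mpr (Or.inr h8)
  obtain ⟨k, hk⟩ : ∃ k, k = Nat.sqrt q := ⟨_, rfl⟩
  have hk1 : q < (k + 1) * (k + 1) := by rw [hk]; exact Nat.lt_succ_sqrt q
  have hk2 : k * k < q := by
    have h1 : k * k ≤ q := by rw [hk]; exact Nat.sqrt_le q
    refine lt_of_le_of_ne h1 ?_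
    intro h
    exact hq.not_isSquare ⟨k, h.symm⟩
  obtain ⟨a, b, hab, hf⟩ := Fintype.exists_ne_map_eq_of_card_lt
    (fun z : Fin (k + 1) × Fin (k + 1) => ((z.1 : ℕ) : ZMod q) - s * ((z.2 : ℕ) : ZMod q))
    (by simpa [ZMod.card] using hk1)
  obtain ⟨x, hx⟩ : ∃ x : ℤ, x = (a.1 : ℕ) - (b.1 : ℕ) := ⟨_, rfl⟩
  obtain ⟨y, hy⟩ : ∃ y : ℤ, y = (a.2 : ℕ) - (b.2 : ℕ) := ⟨_, rfl⟩
  have hxy : (x : ZMod q) = s * y := by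
    rw [hx, hy]; push_cast
    linear_combination hf
  have hdvd : (q : ℤ) ∣ x ^ 2 - 2 * y ^ 2 := by
    rw [← ZMod.intCast_zmod_eq_zero_iff_dvd]
    push_cast
    rw [hxy, hs]; ring
  have hxk : x ^ 2 < q := by
    have h1 := a.1.isLt
    have h2 := b.1.isLt
    have h3 : |x| ≤ k := by rw [abs_le]; omega
    have h4 : x ^ 2 ≤ (k : ℤ) ^ 2 := sq_le_sq' (abs_le.mp h3).1 (abs_le.mp h3).2
    have h5 : (k : ℤ) * k < q := by exact_mod_cast hk2
    nlinarith
  have hyk : y ^ 2 < q := by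
    have h1 := a.2.isLt
    have h2 := b.2.isLt
    have h3 : |y| ≤ k := by rw [abs_le]; omega
    have h4 : y ^ 2 ≤ (k : ℤ) ^ 2 := sq_le_sq' (abs_le.mp h3).1 (abs_le.mp h3).2
    have h5 : (k : ℤ) * k < q := by exact_mod_cast hk2
    nlinarith
  have hne : x ^ 2 - 2 * y ^ 2 ≠ 0 := by
    intro h0
    have hy0 : y = 0 := by
      by_contra hy0
      have h2 : IsSquare (2 : ℚ) := by
        refine ⟨x / y, ?_⟩
        have hy' : (y : ℚ) ≠ 0 := by exact_mod_cast hy0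
        have h0' : (x : ℚ) ^ 2 - 2 * y ^ 2 = 0 := by exact_mod_cast h0
        field_simp
        linear_combination -h0'
      have h3 : IsSquare (2 : ℕ) := by
        have : IsSquare ((2 : ℕ) : ℚ) := by exact_mod_cast h2
        exact Rat.isSquare_natCast_iff.mp this
      exact Nat.prime_two.not_isSquare h3
    have hx0 : x = 0 := by
      rw [hy0] at h0
      simpa using h0
    apply hab
    ext <;> omega
  have hval : x ^ 2 - 2 * y ^ 2 = -q := by
    obtain ⟨c, hc⟩ := hdvd
    have hqp : (0 : ℤ) < q := by exact_mod_cast hq.pos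
    have h1 : c < 1 := by nlinarith [sq_nonneg y]
    have h2 : -2 < c := by nlinarith [sq_nonneg x]
    have h3 : c ≠ 0 := by rintro rfl; exact hne (by rw [hc]; ring)
    have h4 : c = -1 := by omega
    rw [hc, h4]; ring
  have hfin : (x + 2 * y) ^ 2 - 2 * (x + y) ^ 2 = q := by linarith
  refine ⟨|x + 2 * y|, x + y, ?_, by rw [sq_abs]; exact hfin⟩
  rw [abs_pos]
  intro h0
  rw [h0] at hfin
  have hqp : (0 : ℤ) < q := by exact_mod_cast hq.pos
  nlinarith [sq_nonneg (x + y)]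

theorem aux_odd (q : ℕ) (h8 : q % 8 = 7) (x y : ℤ) (h : x ^ 2 - 2 * y ^ 2 = q) :
    x % 2 = 1 ∧ y % 2 = 1 := by
  have h1 : (x ^ 2 - 2 * y ^ 2) % 8 = 7 := by omega
  have hx : x % 8 = 0 ∨ x % 8 = 1 ∨ x % 8 = 2 ∨ x % 8 = 3 ∨ x % 8 = 4 ∨ x % 8 = 5 ∨ x % 8 = 6 ∨
    x % 8 = 7 := by omega
  have hy : y % 2 = 0 ∨ y % 2 = 1 := by omega
  obtain ⟨a, ha⟩ : ∃ a, a = x / 2 := ⟨_, rfl⟩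
  obtain ⟨b, hb⟩ : ∃ b, b = y / 2 := ⟨_, rfl⟩
  rcases Int.emod_two_eq_zero_or_one x with hx | hx
  · exfalso
    have hx' : x = 2 * a := by omega
    rw [hx'] at h1
    ring_nf at h1
    omega
  · refine ⟨hx, ?_⟩
    rcases Int.emod_two_eq_zero_or_one y with hy | hy
    · exfalso
      have hx' : x = 2 * a + 1 := by omega
      have hy' : y = 2 * b := by omega
      rw [hx', hy'] at h1
      ring_nf at h1
      omega
    · exact hy

theorem aux_AB (q₁ q₂ : ℕ) (hq₁ : q₁.Prime) (hq₂ : q₂.Prime) (hne : q₁ ≠ q₂)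
    (h1 : q₁ % 8 = 7) (h2 : q₂ % 8 = 7) :
    ∃ A B : ℤ, 0 < A ∧ A ^ 2 - 2 * B ^ 2 = q₁ * q₂ ∧
      ((A % 4 = 1 ∧ B % 4 = 0) ∨ (A % 4 = 3 ∧ B % 4 = 2)) ∧
      IsCoprime (2 * A) (A ^ 2 - 2 * B ^ 2) := by
  obtain ⟨x₁, y₁, hx₁, e₁⟩ := aux_pell q₁ hq₁ h1
  obtain ⟨x₂, z₂, hx₂, f₂⟩ := aux_pell q₂ hq₂ h2
  obtain ⟨ox₁, oy₁⟩ := aux_odd q₁ h1 _ _ e₁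
  obtain ⟨ox₂, oz₂⟩ := aux_odd q₂ h2 _ _ f₂
  obtain ⟨y₂, e₂, hy⟩ : ∃ y₂ : ℤ, x₂ ^ 2 - 2 * y₂ ^ 2 = q₂ ∧ y₂ % 4 = y₁ % 4 := by
    by_cases hz : z₂ % 4 = y₁ % 4
    · exact ⟨z₂, f₂, hz⟩
    · exact ⟨-z₂, by rw [neg_sq]; exact f₂, by omega⟩
  have hN : (x₁ * x₂ + 2 * y₁ * y₂) ^ 2 - 2 * (x₁ * y₂ + x₂ * y₁) ^ 2 = q₁ * q₂ := by
    rw [← e₁, ← e₂]; ring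
  have hp₁ : (0 : ℤ) < q₁ := by exact_mod_cast hq₁.pos
  have hp₂ : (0 : ℤ) < q₂ := by exact_mod_cast hq₂.pos
  have hmod : ((x₁ * x₂ + 2 * y₁ * y₂) % 4 = 1 ∧ (x₁ * y₂ + x₂ * y₁) % 4 = 0) ∨
      ((x₁ * x₂ + 2 * y₁ * y₂) % 4 = 3 ∧ (x₁ * y₂ + x₂ * y₁) % 4 = 2) := by
    have a1 : x₁ % 4 = 1 ∨ x₁ % 4 = 3 := by omega
    have a2 : x₂ % 4 = 1 ∨ x₂ % 4 = 3 := by omega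
    have a3 : y₁ % 4 = 1 ∨ y₁ % 4 = 3 := by omega
    rcases a1 with a1 | a1 <;> rcases a2 with a2 | a2 <;> rcases a3 with a3 | a3 <;>
      rw [a3] at hy <;>
      simp [Int.add_emod, Int.mul_emod, a1, a2, a3, hy]
  have hA : 0 < x₁ * x₂ + 2 * y₁ * y₂ := by
    have b1 : 2 * y₁ ^ 2 < x₁ ^ 2 := by linarith
    have b2 : 2 * y₂ ^ 2 < x₂ ^ 2 := by linarith
    have b3 : (2 * y₁ * y₂) ^ 2 < (x₁ * x₂) ^ 2 := by
      have := mul_lt_mul'' b1 b2 (by positivity) (by positivity)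
      nlinarith
    have b4 := abs_lt_of_sq_lt_sq b3 (by positivity)
    linarith [(abs_lt.mp b4).1]
  generalize x₁ * x₂ + 2 * y₁ * y₂ = A at *
  generalize x₁ * y₂ + x₂ * y₁ = B at *
  refine ⟨A, B, hA, hN, hmod, ?_⟩
  have key : ∀ q : ℕ, q.Prime → q % 8 = 7 → ∀ q' : ℕ, q'.Prime → q ≠ q' →
      A ^ 2 - 2 * B ^ 2 = q * q' → IsCoprime (2 * A) (q : ℤ) := by
    intro q hq h8 q' hq' hqq' hN
    have hqz : Prime (q : ℤ) := Nat.prime_iff_prime_int.mp hq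
    have hn2 : ¬ (q : ℤ) ∣ 2 := by
      intro h
      have := Int.le_of_dvd (by norm_num) h
      omega
    rw [isCoprime_comm, Prime.coprime_iff_not_dvd hqz]
    intro hd
    rcases hqz.dvd_or_dvd hd with hd | ⟨a, ha⟩
    · exact hn2 hd
    · have hB : (q : ℤ) ∣ B := by
        have : (q : ℤ) ∣ 2 * B ^ 2 := ⟨q * a ^ 2 - q', by rw [ha] at hN; linear_combination -hN⟩
        rcases hqz.dvd_or_dvd this with h | h
        · exact absurd h hn2
        · exact hqz.dvd_of_dvd_pow h
      obtain ⟨b, hb⟩ := hB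
      have hd' : (q : ℤ) ∣ q' := by
        refine ⟨a ^ 2 - 2 * b ^ 2, ?_⟩
        apply mul_left_cancel₀ hqz.ne_zero
        rw [← hN, ha, hb]; ring
      exact hqq' ((Nat.prime_dvd_prime_iff_eq hq hq').mp (by exact_mod_cast hd'))
  rw [hN]
  exact (key q₁ hq₁ h1 q₂ hq₂ hne hN).mul_right
    (key q₂ hq₂ h2 q₁ hq₁ hne.symm (by rw [hN, mul_comm]))


theorem aux_ns (K : Type*) [Field K] [CharZero K] (u t s : K) (p N : ℕ)
    (hu : u ^ 2 = p) (ht : t ^ 2 = N) (hs : s ^ 2 = 2) (hN : ¬ IsSquare N) (hN0 : N ≠ 0)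
    (hgen : ∀ L : Subfield K, u ∈ L → t ∈ L → s ∈ L → ∀ x, x ∈ L) :
    NumberField K ∧ ∀ A B : ℤ, A ^ 2 - 2 * B ^ 2 = N → ∀ r : K, r ^ 2 ≠ A + B * s := by
  have h_integral : ∀ (x : K) (m : ℕ), x ^ 2 = m → IsIntegral ℚ x := by
    intro x m h
    refine ⟨Polynomial.X ^ 2 - Polynomial.C (m : ℚ), Polynomial.monic_X_pow_sub_C _ two_ne_zero, ?_⟩
    simp [h]
  have hspl : ∀ (x : K) (m : ℕ), x ^ 2 = m →
      ((minpoly ℚ x).map (algebraMap ℚ K)).Splits := by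
    intro x m h
    have h1 : minpoly ℚ x ∣ Polynomial.X ^ 2 - Polynomial.C (m : ℚ) := by
      apply minpoly.dvd; simp [h]
    have h2 := Polynomial.map_dvd (algebraMap ℚ K) h1
    refine Polynomial.Splits.of_dvd ?_ ?_ h2
    · have h3 : (Polynomial.X ^ 2 - Polynomial.C (m : ℚ)).map (algebraMap ℚ K)
          = (Polynomial.X - Polynomial.C x) * (Polynomial.X - Polynomial.C (-x)) := by
        have h4 : (Polynomial.C (m : K)) = Polynomial.C x ^ 2 := by rw [← h, Polynomial.C_pow]
        rw [Polynomial.map_sub, Polynomial.map_pow, Polynomial.map_X, Polynomial.map_C,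
          map_natCast (algebraMap ℚ K), Polynomial.C_neg, h4]
        ring
      rw [h3]
      exact (Polynomial.Splits.X_sub_C _).mul (Polynomial.Splits.X_sub_C _)
    · exact Polynomial.map_ne_zero (Polynomial.X_pow_sub_C_ne_zero (by norm_num) _)
  have hs' : s ^ 2 = ((2 : ℕ) : K) := by rw [hs]; norm_num
  have hS : ∀ x ∈ ({u, t, s} : Set K), ∃ m : ℕ, x ^ 2 = m := by
    rintro x (rfl | rfl | rfl)
    · exact ⟨_, hu⟩
    · exact ⟨_, ht⟩
    · exact ⟨_, hs'⟩
  have htop : IntermediateField.adjoin ℚ ({u, t, s} : Set K) = ⊤ := by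
    rw [eq_top_iff]
    intro x _
    refine hgen (IntermediateField.adjoin ℚ ({u, t, s} : Set K)).toSubfield ?_ ?_ ?_ x
    · exact IntermediateField.subset_adjoin _ _ (by simp)
    · exact IntermediateField.subset_adjoin _ _ (by simp)
    · exact IntermediateField.subset_adjoin _ _ (by simp)
  have hfd : FiniteDimensional ℚ K := by
    have h1 : FiniteDimensional ℚ (IntermediateField.adjoin ℚ ({u, t, s} : Set K)) := by
      apply IntermediateField.finiteDimensional_adjoin
      intro x hx
      obtain ⟨m, hm⟩ := hS x hx
      exact h_integral x m hm
    rw [htop] at h1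
    exact IntermediateField.topEquiv.toLinearEquiv.finiteDimensional
  have hnorm : Normal ℚ K := by
    rw [normal_iff]
    intro x
    refine ⟨IsIntegral.of_finite ℚ x, ?_⟩
    refine IntermediateField.splits_of_mem_adjoin ℚ K (S := {u, t, s}) ?_ (by rw [htop]; trivial)
    intro y hy
    obtain ⟨m, hm⟩ := hS y hy
    exact ⟨h_integral y m hm, hspl y m hm⟩
  have hgal : IsGalois ℚ K := ⟨⟩
  refine ⟨⟨⟩, ?_⟩
  intro A B hAB r hr
  have hpm : ∀ (σ : K ≃ₐ[ℚ] K) (x : K) (m : ℕ), x ^ 2 = m → σ x = x ∨ σ x = -x := by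
    intro σ x m h
    apply sq_eq_sq_iff_eq_or_eq_neg.mp
    rw [← map_pow, h, map_natCast]
  have hmove : ∀ (x : K) (m : ℕ), x ^ 2 = m → ¬ IsSquare m → ∃ σ : K ≃ₐ[ℚ] K, σ x = -x := by
    intro x m h hm
    by_contra hcon
    push Not at hcon
    have h1 : ∀ σ : K ≃ₐ[ℚ] K, σ x = x := fun σ => (hpm σ x m h).resolve_right (hcon σ)
    obtain ⟨a, ha⟩ := IntermediateField.mem_bot.mp ((IsGalois.mem_bot_iff_fixed x).mpr h1)
    apply hm
    rw [← Rat.isSquare_natCast_iff]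
    refine ⟨a, (algebraMap ℚ K).injective ?_⟩
    rw [map_mul, ha, map_natCast, ← h, pow_two]
  have ht0 : t ≠ 0 := by
    rintro rfl
    rw [zero_pow two_ne_zero] at ht
    exact hN0 (by exact_mod_cast ht.symm)
  obtain ⟨σ, hσs, hσt⟩ : ∃ σ : K ≃ₐ[ℚ] K, σ s = -s ∧ σ t = -t := by
    obtain ⟨σ₁, h₁⟩ := hmove s 2 hs' Nat.prime_two.not_isSquare
    obtain ⟨σ₂, h₂⟩ := hmove t N ht hN
    rcases hpm σ₁ t N ht with h₃ | h₃
    · rcases hpm σ₂ s 2 hs' with h₄ | h₄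
      · refine ⟨σ₁ * σ₂, ?_, ?_⟩
        · rw [AlgEquiv.mul_apply, h₄, h₁]
        · rw [AlgEquiv.mul_apply, h₂, map_neg, h₃]
      · exact ⟨σ₂, h₄, h₂⟩
    · exact ⟨σ₁, h₁, h₃⟩
  have hσσ' : ∀ (x : K) (m : ℕ), x ^ 2 = m → σ (σ x) = x := by
    intro x m h
    rcases hpm σ x m h with h1 | h1
    · rw [h1, h1]
    · rw [h1, map_neg, h1, neg_neg]
  have hσσ : σ (σ r) = r :=
    hgen (RingHom.eqLocusField (((σ * σ : K ≃ₐ[ℚ] K) : K →+* K)) (RingHom.id K))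
      (hσσ' u p hu) (hσσ' t N ht) (hσσ' s 2 hs') r
  have hprod : (r * σ r) ^ 2 = t ^ 2 := by
    have h1 : (A : K) ^ 2 - 2 * B ^ 2 = N := by exact_mod_cast congrArg (Int.cast : ℤ → K) hAB
    rw [mul_pow, ← map_pow, hr, map_add, map_mul, hσs, map_intCast, map_intCast, ht, ← h1]
    linear_combination -(B : K) ^ 2 * hs
  have hfix : σ (r * σ r) = r * σ r := by rw [map_mul, hσσ, mul_comm]
  have h2t : (2 : K) * t = 0 := by
    rcases sq_eq_sq_iff_eq_or_eq_neg.mp hprod with h | h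
    · rw [h, hσt] at hfix; linear_combination -hfix
    · rw [h, map_neg, hσt] at hfix; linear_combination hfix
  exact ht0 (by simpa using h2t)

theorem aux_treal (K : Type*) [Field K] [NumberField K] (u t s : K) (p N : ℕ)
    (hu : u ^ 2 = p) (ht : t ^ 2 = N) (hs : s ^ 2 = 2)
    (hgen : ∀ L : Subfield K, u ∈ L → t ∈ L → s ∈ L → ∀ x, x ∈ L) : IsTotallyReal K := by
  refine ⟨fun v => InfinitePlace.isReal_iff.mpr ?_⟩
  generalize v.embedding = φ
  rw [ComplexEmbedding.isReal_iff]
  have hg : ∀ (x : K) (m : ℕ), x ^ 2 = m → (starRingEnd ℂ) (φ x) = φ x := by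
    intro x m h
    refine aux_real (r := (m : ℝ)) (by positivity) ?_
    rw [← map_pow, h, map_natCast]
    norm_num
  ext y
  exact hgen (RingHom.eqLocusField (ComplexEmbedding.conjugate φ) φ)
    (hg u p hu) (hg t N ht) (hg s 2 (by rw [hs]; norm_num)) y


/-- Let p, q₁, q₂ be primes with p ≡ 1 (mod 4), q₁ ≡ q₂ ≡ 7 (mod 8), and
(q₂/p) = -1. Then the class number of K₁ = Q(√p, √(q₁q₂), √2) is even. -/
theorem stmt6 (p q₁ q₂ : ℕ) (hp : p.Prime) (hq₁ : q₁.Prime) (hq₂ : q₂.Prime)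
    (hpq₁ : p ≠ q₁) (hpq₂ : p ≠ q₂) (hq₁q₂ : q₁ ≠ q₂)
    (hp4 : p % 4 = 1) (hq₁8 : q₁ % 8 = 7) (hq₂8 : q₂ % 8 = 7)
    (hleg : @legendreSym p ⟨hp⟩ (q₂ : ℤ) = -1) :
    Even (Nat.card (ClassGroup
      (𝓞 (Qadj {Real.sqrt p, Real.sqrt (q₁ * q₂), Real.sqrt 2})))) := by
  obtain ⟨S, hSdef⟩ : ∃ S : Set ℝ, S = {Real.sqrt p, Real.sqrt (q₁ * q₂), Real.sqrt 2} := ⟨_, rfl⟩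
  rw [← hSdef]
  have hmem : ∀ x ∈ S, x ∈ Qadj S := fun x hx => IntermediateField.subset_adjoin ℚ S hx
  obtain ⟨u, hu'⟩ : ∃ u : Qadj S, (u : ℝ) = Real.sqrt p := ⟨⟨_, hmem _ (by simp [hSdef])⟩, rfl⟩
  obtain ⟨t, ht'⟩ : ∃ u : Qadj S, (u : ℝ) = Real.sqrt (q₁ * q₂) :=
    ⟨⟨_, hmem _ (by simp [hSdef])⟩, rfl⟩
  obtain ⟨s, hs'⟩ : ∃ u : Qadj S, (u : ℝ) = Real.sqrt 2 := ⟨⟨_, hmem _ (by simp [hSdef])⟩, rfl⟩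
  have hu : u ^ 2 = (p : Qadj S) := by
    apply Subtype.ext
    push_cast
    rw [hu', Real.sq_sqrt (by positivity)]
  have ht : t ^ 2 = ((q₁ * q₂ : ℕ) : Qadj S) := by
    apply Subtype.ext
    push_cast
    rw [ht', Real.sq_sqrt (by positivity)]
  have hs : s ^ 2 = 2 := by
    apply Subtype.ext
    change (s : ℝ) ^ 2 = 2
    rw [hs', Real.sq_sqrt (by positivity)]
  have hgen : ∀ L : Subfield (Qadj S), u ∈ L → t ∈ L → s ∈ L → ∀ x, x ∈ L := by
    intro L hu2 ht2 hs2 x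
    obtain ⟨x, hx⟩ := x
    have : ∃ h : x ∈ Qadj S, (⟨x, h⟩ : Qadj S) ∈ L := by
      refine IntermediateField.adjoin_induction ℚ (s := S)
        (p := fun x _ => ∃ h : x ∈ Qadj S, (⟨x, h⟩ : Qadj S) ∈ L) ?_ ?_ ?_ ?_ ?_ hx
      · intro y hy
        refine ⟨hmem y hy, ?_⟩
        rw [hSdef] at hy
        rcases hy with h | h | h
        · have : (⟨y, hmem y (by rw [hSdef, h]; simp)⟩ : Qadj S) = u := Subtype.ext (h.trans hu'.symm)
          rw [this]; exact hu2
        · have : (⟨y, hmem y (by rw [hSdef, h]; simp)⟩ : Qadj S) = t := Subtype.ext (h.trans ht'.symm)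
          rw [this]; exact ht2
        · have h : y = Real.sqrt 2 := h
          have : (⟨y, hmem y (by rw [hSdef, h]; simp)⟩ : Qadj S) = s := Subtype.ext (h.trans hs'.symm)
          rw [this]; exact hs2
      · intro a
        refine ⟨(Qadj S).algebraMap_mem a, ?_⟩
        have h1 : (⟨algebraMap ℚ ℝ a, (Qadj S).algebraMap_mem a⟩ : Qadj S) = (a : Qadj S) := by
          apply Subtype.ext
          simp
        rw [h1]
        exact SubfieldClass.ratCast_mem L a
      · rintro a b _ _ ⟨ha, ha'⟩ ⟨hb, hb'⟩
        exact ⟨add_mem ha hb, add_mem ha' hb'⟩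
      · rintro a _ ⟨ha, ha'⟩
        exact ⟨inv_mem ha, inv_mem ha'⟩
      · rintro a b _ _ ⟨ha, ha'⟩ ⟨hb, hb'⟩
        exact ⟨mul_mem ha hb, mul_mem ha' hb'⟩
    exact this.2
  have hnsq : ¬ IsSquare (q₁ * q₂) := by
    rintro ⟨c, hc⟩
    have h1 : q₁ ∣ c := by
      have : q₁ ∣ c * c := ⟨q₂, hc.symm⟩
      rcases hq₁.dvd_mul.mp this with h | h <;> exact h
    obtain ⟨d, rfl⟩ := h1
    have h2 : q₁ ∣ q₂ := by
      refine ⟨d * d, ?_⟩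
      apply Nat.eq_of_mul_eq_mul_left hq₁.pos
      rw [hc]; ring
    exact hq₁q₂ ((Nat.prime_dvd_prime_iff_eq hq₁ hq₂).mp h2)
  obtain ⟨hnf, hns⟩ := aux_ns (Qadj S) u t s p (q₁ * q₂) hu ht hs hnsq
    (mul_ne_zero hq₁.ne_zero hq₂.ne_zero) hgen
  have hreal := aux_treal (Qadj S) u t s p (q₁ * q₂) hu ht hs hgen
  obtain ⟨A, B, hA, hN, hmod, hco⟩ := aux_AB q₁ q₂ hq₁ hq₂ hq₁q₂ hq₁8 hq₂8
  refine aux_concrete (Qadj S) s t A B hs ?_ hA ?_ hmod hco (hns A B (by rw [hN]; push_cast; rfl))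
  · rw [ht]
    have := congrArg (Int.cast : ℤ → Qadj S) hN
    push_cast at this ⊢
    exact this.symm
  · rw [hN]
    have h1 := hq₁.pos
    have h2 := hq₂.pos
    positivity
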